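/- arXiv:2506.00496 — 3 statements merged into one kernel-verified Lean document; each statement's English description precedes it below -/
import Mathlib

section
/- Let ε > 0 and δ > 0 be real constants, let n : ℕ, and let x, z : Fin n → ℝ be such that the pairs are consistent (for all i, j, x i = x j implies z i = z j) and the sequence (x_i, z_i) is runtime (ε, δ)-input-output robust (for all i, j, |x i − x j| ≤ ε implies |z i − z j| ≤ δ). Then there exists a classifier D : ℝ → ℝ with D (x i) = z i for all i, such that D is NOT globally (ε, δ)-input-output robust, i.e., there exist a, b ∈ ℝ with |a − b| ≤ ε and |D a − D b| > δ. In particular, runtime (ε, δ)-input-output robustness of a decision sequence does not imply global (ε, δ)-input-output robustness of a classifier generating it. (Theorem 1, Claim 2, instantiated over the infinite input space ℝ with the absolute-value metric.) -/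
/-- Theorem 1, Claim 2 (instantiated over ℝ with the absolute-value metric):
a runtime (ε, δ)-input-output robust decision sequence can be generated by a
classifier that is not globally (ε, δ)-input-output robust. -/
theorem runtime_ior_not_implies_global_ior
    (ε δ : ℝ) (hε : ε > 0) (hδ : δ > 0)
    (n : ℕ) (x z : Fin n → ℝ)
    (hconsistent : ∀ i j : Fin n, x i = x j → z i = z j)
    (hruntime : ∀ i j : Fin n, |x i - x j| ≤ ε → |z i - z j| ≤ δ) :
    ∃ D : ℝ → ℝ,
      (∀ i : Fin n, D (x i) = z i) ∧
      (∃ a b : ℝ, |a - b| ≤ ε ∧ |D a - D b| > δ) := by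
  obtain ⟨M, hM⟩ := (Set.finite_range x).bddAbove
  have not_mem {t : ℝ} (ht : M < t) : ¬∃ i, x i = t := fun h => (hM h).not_gt ht
  refine ⟨Function.extend x z fun t => if t = M + ε then δ + 1 else 0,
    (Function.FactorsThrough.extend_apply (fun i j h => hconsistent i j h) _),
    M + ε, M + ε + ε, by simp [abs_of_pos hε], ?_⟩
  rw [Function.extend_apply' _ _ _ (not_mem (by linarith)),
    Function.extend_apply' _ _ _ (not_mem (by linarith)), if_pos rfl, if_neg (by linarith),
    sub_zero, abs_of_pos (by linarith)]
  linarith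
end

section
/- Let X and Z be metric spaces, let ε > 0 and δ > 0 be real constants, and let (x, z) : Fin n → X × Z be a finite sequence. Then the sequence is runtime (ε, δ)-input-output robust if and only if the i.o.r. monitor outputs the empty set at every step, i.e., if and only if for every k < n, the set { i < k : d_X(x k, x i) ≤ ε and d_Z(z k, z i) > δ } is empty. -/
/-- A finite decision sequence is runtime (ε, δ)-input-output robust iff the
i.o.r. monitor outputs the empty set at every step. -/
theorem runtime_ior_iff_monitor_empty
    {X Z : Type*} [MetricSpace X] [MetricSpace Z]
    (ε δ : ℝ) (hε : ε > 0) (hδ : δ > 0)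
    (n : ℕ) (x : Fin n → X) (z : Fin n → Z) :
    (∀ i j : Fin n, dist (x i) (x j) ≤ ε → dist (z i) (z j) ≤ δ) ↔
    (∀ k : Fin n,
      {i : Fin n | (i : ℕ) < (k : ℕ) ∧
        dist (x k) (x i) ≤ ε ∧ dist (z k) (z i) > δ} = ∅) := by
  constructor
  · intro h k
    refine Set.eq_empty_iff_forall_notMem.mpr ?_
    rintro i ⟨-, hx, hz⟩
    exact (h k i hx).not_gt hz
  · intro h
    have earlier : ∀ i k : Fin n, i < k → dist (x k) (x i) ≤ ε → dist (z k) (z i) ≤ δ := by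
      intro i k hik hx
      by_contra! hz
      exact Set.eq_empty_iff_forall_notMem.mp (h k) i ⟨hik, hx, hz⟩
    intro i j hx
    rcases lt_trichotomy i j with hij | rfl | hij
    · rw [dist_comm] at hx ⊢
      exact earlier i j hij hx
    · rw [dist_self]
      exact hδ.le
    · exact earlier j i hij hx
end

section
/- Let ε > 0 be a real constant, let d : ℕ, and let x, y : Fin d → ℝ. If |x i − y i| ≤ ε for every i (i.e., the L∞ distance between x and y is at most ε), then the label vectors of x and y are adjacent: |⌊x i / ε⌋ − ⌊y i / ε⌋| ≤ 1 for every i. Consequently, for any finite set S of points in Fin d → ℝ, the set of ε-neighbors of x in the L∞ metric, { y ∈ S : ∀ i, |x i − y i| ≤ ε }, equals { y ∈ S : (∀ i, |⌊x i / ε⌋ − ⌊y i / ε⌋| ≤ 1) and ∀ i, |x i − y i| ≤ ε }; hence the top-level label-adjacency search of the BDD-based monitor never misses an ε-neighbor, and the subsequent brute-force filter restricted to points with adjacent labels computes the exact ε-neighbor set. -/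
/-- Reals at distance at most `ε` lie in the same or in neighboring intervals of width `ε`. -/
theorem abs_floor_div_sub_floor_div_le_one {ε a b : ℝ} (hε : 0 < ε) (h : |a - b| ≤ ε) :
    |⌊a / ε⌋ - ⌊b / ε⌋| ≤ 1 := by
  have key : ∀ {u v : ℝ}, u - v ≤ ε → ⌊u / ε⌋ ≤ ⌊v / ε⌋ + 1 := by
    intro u v huv
    rw [← Int.floor_add_one]
    apply Int.floor_le_floor
    rw [div_add_one hε.ne']
    gcongr
    linarith
  obtain ⟨h₁, h₂⟩ := abs_le.mp h
  have hab := key h₂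
  have hba := key (u := b) (v := a) (by linarith)
  rw [abs_le]
  constructor <;> lia

/-- ε-close points (in L∞) have adjacent label vectors; consequently the
top-level label-adjacency search of the BDD-based monitor never misses an
ε-neighbor, and brute-force filtering among points with adjacent labels
computes the exact ε-neighbor set. -/
theorem close_implies_adjacent_labels
    (ε : ℝ) (hε : ε > 0) (d : ℕ) (x : Fin d → ℝ) :
    (∀ y : Fin d → ℝ, (∀ i : Fin d, |x i - y i| ≤ ε) →
      ∀ i : Fin d, |⌊x i / ε⌋ - ⌊y i / ε⌋| ≤ 1) ∧
    (∀ S : Finset (Fin d → ℝ),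
      {y : Fin d → ℝ | y ∈ S ∧ ∀ i : Fin d, |x i - y i| ≤ ε} =
      {y : Fin d → ℝ | y ∈ S ∧
        (∀ i : Fin d, |⌊x i / ε⌋ - ⌊y i / ε⌋| ≤ 1) ∧
        (∀ i : Fin d, |x i - y i| ≤ ε)}) := by
  have adj : ∀ y : Fin d → ℝ, (∀ i : Fin d, |x i - y i| ≤ ε) →
      ∀ i : Fin d, |⌊x i / ε⌋ - ⌊y i / ε⌋| ≤ 1 :=
    fun y hy i => abs_floor_div_sub_floor_div_le_one hε (hy i)
  refine ⟨adj, fun S => Set.ext fun y => ?_⟩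
  exact ⟨fun h => ⟨h.1, adj y h.2, h.2⟩, fun h => ⟨h.1, h.2.2⟩⟩
end
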